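/- Let P be a fixed real n×n matrix, let K be a real n×n matrix with Kᵀ P + P K = 0, and let V₁, …, V_m be real n×n matrices each satisfying Vᵢᵀ P + P Vᵢ = 0. Define V₀ = K + (1/2) ∑_{i=1}^m Vᵢ². Then V₀ᵀ P + P V₀ = − ∑_{i=1}^m Vᵢᵀ P Vᵢ. (This is the algebraic core of Lemma: the drift V₀ = K + (1/2)∑Vᵢ² with tangential K satisfies the condition ensuring that the solution of the matrix SDE stays in the quadratic Lie group G(P).) -/

import Mathlib

open Matrix Finset

/-- The square of an infinitesimal isometry `V` of the bilinear form with matrix `P`. -/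
theorem transpose_sq_mul_add_mul_sq {ι R : Type*} [Fintype ι] [CommRing R]
    {P V : Matrix ι ι R} (hV : Vᵀ * P + P * V = 0) :
    (V * V)ᵀ * P + P * (V * V) = (-2 : R) • (Vᵀ * P * V) := by
  have h : Vᵀ * P = -(P * V) := eq_neg_of_add_eq_zero_left hV
  have h₁ : (V * V)ᵀ * P = -(Vᵀ * P * V) := by
    rw [transpose_mul, Matrix.mul_assoc, h, Matrix.mul_neg, ← Matrix.mul_assoc, h]
  have h₂ : P * (V * V) = -(Vᵀ * P * V) := by
    rw [← Matrix.mul_assoc, h, Matrix.neg_mul, neg_neg]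
  rw [h₁, h₂, neg_smul, two_smul, neg_add]

/-- If `Kᵀ P + P K = 0` and each `Vᵢᵀ P + P Vᵢ = 0`, then
`V₀ = K + (1/2) ∑ᵢ Vᵢ²` satisfies `V₀ᵀ P + P V₀ = - ∑ᵢ Vᵢᵀ P Vᵢ`. -/
theorem quadratic_lie_group_drift_condition {n m : ℕ}
    (P K : Matrix (Fin n) (Fin n) ℝ)
    (V : Fin m → Matrix (Fin n) (Fin n) ℝ)
    (hK : Kᵀ * P + P * K = 0)
    (hV : ∀ i, (V i)ᵀ * P + P * (V i) = 0)
    (V₀ : Matrix (Fin n) (Fin n) ℝ)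
    (hV₀ : V₀ = K + (1 / 2 : ℝ) • ∑ i, V i * V i) :
    V₀ᵀ * P + P * V₀ = -∑ i, (V i)ᵀ * P * (V i) := by
  have hsum : (∑ i, V i * V i)ᵀ * P + P * ∑ i, V i * V i =
      (-2 : ℝ) • ∑ i, (V i)ᵀ * P * V i := by
    rw [transpose_sum, Finset.sum_mul, Finset.mul_sum, ← Finset.sum_add_distrib, Finset.smul_sum]
    exact Finset.sum_congr rfl fun i _ => transpose_sq_mul_add_mul_sq (hV i)
  calc V₀ᵀ * P + P * V₀
      = (Kᵀ * P + P * K) +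
          (1 / 2 : ℝ) • ((∑ i, V i * V i)ᵀ * P + P * ∑ i, V i * V i) := by
        rw [hV₀, transpose_add, transpose_smul, Matrix.add_mul, Matrix.mul_add,
          Matrix.smul_mul, Matrix.mul_smul, smul_add]
        abel
    _ = -∑ i, (V i)ᵀ * P * V i := by
        rw [hK, hsum, zero_add, smul_smul]
        norm_num
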